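/- arXiv:1306.4553 — 2 statements merged into one kernel-verified Lean document; each statement's English description precedes it below -/
import Mathlib

section
/- Let j, k, n be positive integers with j < n and j < k, and let p₀,…,p_k ∈ ℝ^{1,n} be (k+1) points such that dim V(p₀,…,p_j) = dim V(p₀,…,p_k) = j. Then the Lorentzian distance-squared mapping L_{(p₀,…,p_k)} : ℝ^{1,n} → ℝ^{k+1} is A-equivalent to τ ∘ Ψ_j if and only if the recognition subspace V(p₀,…,p_k) is space-like, where τ : ℝ^{j+1} → ℝ^{k+1} is the inclusion τ(X₀,…,X_j) = (X₀,…,X_j, 0,…,0). -/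
open scoped BigOperators

noncomputable section

/-- The Lorentzian inner product on `ℝ^{1,n}`, modeled as `Fin (n+1) → ℝ`:
`⟨x,y⟩ = -x₀y₀ + x₁y₁ + ⋯ + xₙyₙ`. -/
def lorIP {n : ℕ} (x y : Fin (n + 1) → ℝ) : ℝ :=
  (∑ i, x i * y i) - 2 * (x 0 * y 0)

/-- The Euclidean inner product on `Fin m → ℝ`. -/
def eucIP {m : ℕ} (x y : Fin m → ℝ) : ℝ := ∑ i, x i * y i

/-- The Lorentzian distance-squared mapping determined by the points `p 0, …, p (m-1)`. -/
def LorDSM {n m : ℕ} (p : Fin m → Fin (n + 1) → ℝ) :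
    (Fin (n + 1) → ℝ) → (Fin m → ℝ) :=
  fun x i => lorIP (x - p i) (x - p i)

/-- The Euclidean distance-squared mapping determined by the points `p 0, …, p (m-1)`. -/
def EucDSM {n m : ℕ} (p : Fin m → Fin (n + 1) → ℝ) :
    (Fin (n + 1) → ℝ) → (Fin m → ℝ) :=
  fun x i => eucIP (x - p i) (x - p i)

/-- The recognition subspace `V(p₀, …, p_k)`: the span of the vectors `p i - p 0`. -/
def recSub {n k : ℕ} (p : Fin (k + 1) → Fin (n + 1) → ℝ) :
    Submodule ℝ (Fin (n + 1) → ℝ) :=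
  Submodule.span ℝ (Set.range fun i => p i - p 0)

/-- The partial recognition subspace `V(p₀, …, p_j)`: the span of `p i - p 0` for `i ≤ j`. -/
def recSubUpTo {n k : ℕ} (p : Fin (k + 1) → Fin (n + 1) → ℝ) (j : ℕ) :
    Submodule ℝ (Fin (n + 1) → ℝ) :=
  Submodule.span ℝ {v | ∃ i : Fin (k + 1), (i : ℕ) ≤ j ∧ v = p i - p 0}

/-- A subspace is time-like iff it contains a vector of negative Lorentzian square. -/
def LTimeLike {n : ℕ} (V : Submodule ℝ (Fin (n + 1) → ℝ)) : Prop :=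
  ∃ v ∈ V, lorIP v v < 0

/-- A subspace is space-like iff every nonzero vector in it has positive Lorentzian square. -/
def LSpaceLike {n : ℕ} (V : Submodule ℝ (Fin (n + 1) → ℝ)) : Prop :=
  ∀ v ∈ V, v ≠ 0 → 0 < lorIP v v

/-- A subspace is light-like iff it is neither time-like nor space-like. -/
def LLightLike {n : ℕ} (V : Submodule ℝ (Fin (n + 1) → ℝ)) : Prop :=
  ¬ LTimeLike V ∧ ¬ LSpaceLike V

/-- `f` and `g` are `𝒜`-equivalent: `g = H ∘ f ∘ h` for `C^∞` diffeomorphisms `h, H`. -/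
def AEquiv {a b : ℕ} (f g : (Fin a → ℝ) → (Fin b → ℝ)) : Prop :=
  ∃ (h : (Fin a → ℝ) ≃ (Fin a → ℝ)) (H : (Fin b → ℝ) ≃ (Fin b → ℝ)),
    ContDiff ℝ (⊤ : ℕ∞) ⇑h ∧ ContDiff ℝ (⊤ : ℕ∞) ⇑h.symm ∧
    ContDiff ℝ (⊤ : ℕ∞) ⇑H ∧ ContDiff ℝ (⊤ : ℕ∞) ⇑H.symm ∧
    g = ⇑H ∘ f ∘ ⇑h

/-- The Lorentzian inner product as a bilinear map. -/
def lorBilin (n : ℕ) : (Fin (n + 1) → ℝ) →ₗ[ℝ] (Fin (n + 1) → ℝ) →ₗ[ℝ] ℝ :=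
  LinearMap.mk₂ ℝ lorIP
    (fun x y z => by
      simp only [lorIP, Pi.add_apply, add_mul, Finset.sum_add_distrib]; ring)
    (fun c x y => by
      simp only [lorIP, Pi.smul_apply, smul_eq_mul, mul_assoc, ← Finset.mul_sum]; ring)
    (fun x y z => by
      simp only [lorIP, Pi.add_apply, mul_add, Finset.sum_add_distrib]; ring)
    (fun c x y => by
      simp only [lorIP, Pi.smul_apply, smul_eq_mul, mul_left_comm _ c, ← Finset.mul_sum]; ring)

@[simp]
lemma lorBilin_apply {n : ℕ} (x y : Fin (n + 1) → ℝ) : lorBilin n x y = lorIP x y := rfl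

lemma lorIP_comm {n : ℕ} (x y : Fin (n + 1) → ℝ) : lorIP x y = lorIP y x := by
  simp only [lorIP, mul_comm]

lemma lorIP_add_left {n : ℕ} (x y z : Fin (n + 1) → ℝ) :
    lorIP (x + y) z = lorIP x z + lorIP y z := (lorBilin n).map_add₂ x y z

lemma lorIP_sub_left {n : ℕ} (x y z : Fin (n + 1) → ℝ) :
    lorIP (x - y) z = lorIP x z - lorIP y z := (lorBilin n).map_sub₂ x y z

lemma lorIP_smul_left {n : ℕ} (c : ℝ) (x y : Fin (n + 1) → ℝ) :
    lorIP (c • x) y = c * lorIP x y := (lorBilin n).map_smul₂ c x y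

lemma lorIP_add_right {n : ℕ} (x y z : Fin (n + 1) → ℝ) :
    lorIP x (y + z) = lorIP x y + lorIP x z := (lorBilin n x).map_add y z

lemma lorIP_sub_right {n : ℕ} (x y z : Fin (n + 1) → ℝ) :
    lorIP x (y - z) = lorIP x y - lorIP x z := (lorBilin n x).map_sub y z

lemma lorIP_smul_right {n : ℕ} (c : ℝ) (x y : Fin (n + 1) → ℝ) :
    lorIP x (c • y) = c * lorIP x y := (lorBilin n x).map_smul c y

lemma lorIP_sum_smul_right {n m : ℕ} (x : Fin (n + 1) → ℝ) (c : Fin m → ℝ)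
    (v : Fin m → Fin (n + 1) → ℝ) :
    lorIP x (∑ i, c i • v i) = ∑ i, c i * lorIP x (v i) := by
  rw [← lorBilin_apply, map_sum]
  simp

lemma lorIP_sub_self {n : ℕ} (x y : Fin (n + 1) → ℝ) :
    lorIP (x - y) (x - y) = lorIP x x - 2 * lorIP x y + lorIP y y := by
  rw [lorIP_sub_left, lorIP_sub_right, lorIP_sub_right, lorIP_comm y x]; ring

lemma lorIP_self {n : ℕ} (x : Fin (n + 1) → ℝ) :
    lorIP x x = -x 0 ^ 2 + ∑ i : Fin n, x i.succ ^ 2 := by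
  simp only [lorIP, Fin.sum_univ_succ, pow_two]; ring

lemma lorIP_single_zero {n : ℕ} (x : Fin (n + 1) → ℝ) :
    lorIP x (Pi.single 0 1) = -x 0 := by
  simp [lorIP, Pi.single_apply]; ring

lemma lorIP_left_eq_zero {n : ℕ} {x : Fin (n + 1) → ℝ} (h : ∀ y, lorIP x y = 0) : x = 0 := by
  funext i
  have h0 := h (Pi.single 0 1)
  have hi := h (Pi.single i 1)
  rw [lorIP_single_zero] at h0
  have h0' : x 0 = 0 := by linarith
  simpa [lorIP, h0', Pi.single_apply] using hi

lemma eq_zero_of_lorIP_self_nonpos {n : ℕ} {x : Fin (n + 1) → ℝ} (h0 : x 0 = 0)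
    (h : lorIP x x ≤ 0) : x = 0 := by
  rw [lorIP_self, h0] at h
  have hs : ∑ i : Fin n, x i.succ ^ 2 = 0 :=
    le_antisymm (by linarith) (Finset.sum_nonneg fun i _ => sq_nonneg _)
  rw [Finset.sum_eq_zero_iff_of_nonneg fun i _ => sq_nonneg _] at hs
  funext i
  refine Fin.cases h0 (fun i => ?_) i
  simpa using hs i (Finset.mem_univ i)

/-- Two orthogonal vectors, neither of them space-like, are proportional. -/
lemma eq_smul_of_lorIP_eq_zero {n : ℕ} {u v : Fin (n + 1) → ℝ} (hu : lorIP u u ≤ 0)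
    (hv : lorIP v v ≤ 0) (hv0 : v ≠ 0) (huv : lorIP u v = 0) : u = (u 0 / v 0) • v := by
  have hv00 : v 0 ≠ 0 := fun h => hv0 (eq_zero_of_lorIP_self_nonpos h hv)
  rw [← sub_eq_zero]
  refine eq_zero_of_lorIP_self_nonpos ?_ ?_
  · simp [hv00]
  · rw [lorIP_sub_self, lorIP_smul_left, lorIP_smul_right, lorIP_smul_right, huv]
    nlinarith [mul_nonneg (mul_self_nonneg (u 0 / v 0)) (neg_nonneg.2 hv)]

/-- The orthogonal complement of a time-like vector is space-like. -/
lemma lorIP_self_pos_of_orthogonal {n : ℕ} {w y : Fin (n + 1) → ℝ} (hw : lorIP w w < 0)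
    (hyw : lorIP y w = 0) (hy : y ≠ 0) : 0 < lorIP y y := by
  by_contra! h
  have hw0 : w ≠ 0 := by rintro rfl; simp [lorIP] at hw
  have e := eq_smul_of_lorIP_eq_zero h hw.le hw0 hyw
  rw [e, lorIP_smul_left] at hyw
  rcases mul_eq_zero.1 hyw with h0 | h0
  · exact hy (by rw [e, h0, zero_smul])
  · exact hw.ne h0

/-- Reversing the sign along a unit time-like vector makes the Lorentzian form positive definite. -/
lemma lorIP_self_add_sq_pos {n : ℕ} {w x : Fin (n + 1) → ℝ} (hw : lorIP w w = -1)
    (hx : x ≠ 0) : 0 < lorIP x x + 2 * lorIP x w ^ 2 := by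
  set y := x + lorIP x w • w with hy
  have hyw : lorIP y w = 0 := by rw [hy, lorIP_add_left, lorIP_smul_left, hw]; ring
  have hyy : lorIP y y = lorIP x x + lorIP x w ^ 2 := by
    conv_lhs => rw [hy]
    rw [lorIP_add_left, lorIP_add_right, lorIP_add_right, lorIP_smul_left, lorIP_smul_right,
      lorIP_smul_left, lorIP_smul_right, hw, lorIP_comm w x]
    ring
  by_cases h0 : y = 0
  · have hc : lorIP x w ≠ 0 := by
      intro hc
      rw [hc, zero_smul, add_zero] at hy
      exact hx (hy ▸ h0)
    rw [h0] at hyy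
    have : lorIP (0 : Fin (n + 1) → ℝ) 0 = 0 := by simp [lorIP]
    have : 0 < lorIP x w ^ 2 := by positivity
    linarith
  · have := lorIP_self_pos_of_orthogonal (by rw [hw]; norm_num) hyw h0
    nlinarith [sq_nonneg (lorIP x w)]

/-- The orthogonal complement of a space-like subspace contains a unit time-like vector. -/
lemma exists_unit_timeLike_orthogonal {n : ℕ} {V : Submodule ℝ (Fin (n + 1) → ℝ)}
    (hV : LSpaceLike V) :
    ∃ w : Fin (n + 1) → ℝ, lorIP w w = -1 ∧ ∀ v ∈ V, lorIP w v = 0 := by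
  let φ : V →ₗ[ℝ] Module.Dual ℝ V := (lorBilin n).domRestrict₁₂ V V
  have hinj : Function.Injective φ := by
    rw [← LinearMap.ker_eq_bot, LinearMap.ker_eq_bot']
    intro v hv
    by_contra h
    have h1 := hV v v.2 (by simpa using h)
    have h2 : φ v v = 0 := by rw [hv]; rfl
    exact h1.ne' h2
  have hsurj : Function.Surjective φ :=
    (LinearMap.injective_iff_surjective_of_finrank_eq_finrank
      (Subspace.dual_finrank_eq).symm).1 hinj
  obtain ⟨v, hv⟩ := hsurj ((lorBilin n (Pi.single 0 1)).domRestrict V)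
  have horth : ∀ u ∈ V, lorIP (Pi.single 0 1 - (v : Fin (n + 1) → ℝ)) u = 0 := by
    intro u hu
    have := LinearMap.congr_fun hv ⟨u, hu⟩
    change lorIP (v : Fin (n + 1) → ℝ) u = lorIP (Pi.single 0 1) u at this
    rw [lorIP_sub_left, this, sub_self]
  set w : Fin (n + 1) → ℝ := Pi.single 0 1 - (v : Fin (n + 1) → ℝ) with hw
  have hvv : 0 ≤ lorIP (v : Fin (n + 1) → ℝ) v := by
    by_cases h : (v : Fin (n + 1) → ℝ) = 0
    · rw [h]; simp [lorIP]
    · exact (hV v v.2 h).le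
  have hneg : lorIP w w < 0 := by
    have h1 := horth v v.2
    have h2 : lorIP (Pi.single 0 1 : Fin (n + 1) → ℝ) (Pi.single 0 1) = -1 := by
      rw [lorIP_single_zero]; simp
    rw [hw, lorIP_sub_left] at h1
    rw [hw, lorIP_sub_self, h2]
    linarith
  have hs : Real.sqrt (-lorIP w w) ≠ 0 := (Real.sqrt_pos.2 (by linarith)).ne'
  refine ⟨(Real.sqrt (-lorIP w w))⁻¹ • w, ?_, fun u hu => ?_⟩
  · rw [lorIP_smul_left, lorIP_smul_right]
    have := Real.mul_self_sqrt (show 0 ≤ -lorIP w w by linarith)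
    field_simp
    linarith
  · rw [lorIP_smul_left, horth u hu, mul_zero]

/-- In a Euclidean space, a subspace together with a unit vector orthogonal to it is spanned by an
initial part of an orthonormal basis. -/
lemma exists_orthonormalBasis_adapted {E : Type*} [NormedAddCommGroup E] [InnerProductSpace ℝ E]
    {n j : ℕ} (hE : Module.finrank ℝ E = n + 1) (V : Submodule ℝ E)
    (hV : Module.finrank ℝ V = j) {w : E} (hw : inner ℝ w w = 1)
    (hwV : ∀ v ∈ V, inner ℝ w v = 0) :
    ∃ b : OrthonormalBasis (Fin (n + 1)) ℝ E, b 0 = w ∧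
      ∀ i : Fin (n + 1), 1 ≤ (i : ℕ) → (i : ℕ) ≤ j → b i ∈ V := by
  have : FiniteDimensional ℝ E := Module.finite_of_finrank_pos (by omega)
  let e : OrthonormalBasis (Fin j) ℝ V := (stdOrthonormalBasis ℝ V).reindex (finCongr hV)
  let f : Fin (n + 1) → E := fun i =>
    if h : 1 ≤ (i : ℕ) ∧ (i : ℕ) ≤ j then (e ⟨i - 1, by omega⟩ : E) else w
  have hf : ∀ i : Fin (n + 1), ∀ h : 1 ≤ (i : ℕ) ∧ (i : ℕ) ≤ j,
      f i = (e ⟨i - 1, by omega⟩ : E) := fun i h => dif_pos h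
  have hf0 : ∀ i : Fin (n + 1), (i : ℕ) = 0 → f i = w := fun i h => dif_neg (by omega)
  have hon : Orthonormal ℝ ({i : Fin (n + 1) | (i : ℕ) ≤ j}.domRestrict f) := by
    rw [orthonormal_iff_ite]
    rintro ⟨a, ha⟩ ⟨b, hb⟩
    replace ha : (a : ℕ) ≤ j := ha
    replace hb : (b : ℕ) ≤ j := hb
    simp only [Set.domRestrict_apply, Subtype.mk.injEq]
    by_cases ha0 : (a : ℕ) = 0 <;> by_cases hb0 : (b : ℕ) = 0
    · rw [hf0 a ha0, hf0 b hb0, hw, if_pos (Fin.ext (by omega))]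
    · rw [hf0 a ha0, hf b ⟨by omega, hb⟩, hwV _ (Subtype.coe_prop _),
        if_neg (by rintro rfl; exact hb0 ha0)]
    · rw [hf0 b hb0, hf a ⟨by omega, ha⟩, real_inner_comm, hwV _ (Subtype.coe_prop _),
        if_neg (by rintro rfl; exact ha0 hb0)]
    · rw [hf a ⟨by omega, ha⟩, hf b ⟨by omega, hb⟩, ← Submodule.coe_inner,
        orthonormal_iff_ite.1 e.orthonormal]
      congr 1
      simp only [eq_iff_iff, Fin.ext_iff]
      omega
  obtain ⟨b, hb⟩ := hon.exists_orthonormalBasis_extension_of_card_eq (by simp [hE])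
  refine ⟨b, ?_, fun i h1 h2 => ?_⟩
  · rw [hb 0 (by simp), hf0 0 rfl]
  · rw [hb i h2, hf i ⟨h1, h2⟩]
    exact Subtype.coe_prop _

/-- A positive definite symmetric bilinear form has an orthonormal basis adapted to a subspace and
a unit vector orthogonal to it. -/
lemma exists_frame_of_posDef {E : Type*} [AddCommGroup E] [Module ℝ E] {n j : ℕ}
    (hE : Module.finrank ℝ E = n + 1) (B : E →ₗ[ℝ] E →ₗ[ℝ] ℝ) (hsymm : ∀ x y, B x y = B y x)
    (hpos : ∀ x, x ≠ 0 → 0 < B x x) (V : Submodule ℝ E) (hV : Module.finrank ℝ V = j) {w : E}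
    (hw : B w w = 1) (hwV : ∀ v ∈ V, B w v = 0) :
    ∃ f : Fin (n + 1) → E, f 0 = w ∧
      (∀ i : Fin (n + 1), 1 ≤ (i : ℕ) → (i : ℕ) ≤ j → f i ∈ V) ∧
      (∀ i, B (f i) w = if i = 0 then 1 else 0) ∧
      ∀ x y, B x y = ∑ i, B x (f i) * B (f i) y := by
  let core : InnerProductSpace.Core ℝ E :=
    { inner := fun x y => B x y
      conj_inner_symm := fun x y => by simp only [conj_trivial, hsymm y x]
      re_inner_nonneg := fun x => by
        by_cases h : x = 0
        · simp [h]
        · exact (hpos x h).le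
      add_left := fun x y z => by simp
      smul_left := fun x y r => by simp
      definite := fun x hx => by
        by_contra h
        exact (hpos x h).ne' hx }
  let _ : NormedAddCommGroup E := core.toNormedAddCommGroup
  let _ : InnerProductSpace ℝ E := InnerProductSpace.ofCore core.toCore
  obtain ⟨b, hb0, hbV⟩ := exists_orthonormalBasis_adapted hE V hV (w := w) hw hwV
  refine ⟨b, hb0, hbV, fun i => ?_, fun x y => (b.sum_inner_mul_inner x y).symm⟩
  have := orthonormal_iff_ite.1 b.orthonormal i 0
  rw [hb0] at this
  exact this

/-- A space-like subspace is spanned by vectors of a Lorentzian orthonormal frame, which expresses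
the Lorentzian inner product through coordinates. -/
lemma exists_lorentz_frame {n j : ℕ} {V : Submodule ℝ (Fin (n + 1) → ℝ)}
    (hV : LSpaceLike V) (hVj : Module.finrank ℝ V = j) :
    ∃ f : Fin (n + 1) → Fin (n + 1) → ℝ,
      (∀ i : Fin (n + 1), 1 ≤ (i : ℕ) → (i : ℕ) ≤ j → f i ∈ V) ∧
      ∀ x y, lorIP x y = (∑ i, lorIP x (f i) * lorIP y (f i)) - 2 * (lorIP x (f 0) * lorIP y (f 0))
    := by
  obtain ⟨w, hw, hwV⟩ := exists_unit_timeLike_orthogonal hV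
  let B : (Fin (n + 1) → ℝ) →ₗ[ℝ] (Fin (n + 1) → ℝ) →ₗ[ℝ] ℝ :=
    lorBilin n + 2 • ((LinearMap.mul ℝ ℝ).compl₁₂ ((lorBilin n).flip w) ((lorBilin n).flip w))
  have hB : ∀ x y, B x y = lorIP x y + 2 * (lorIP x w * lorIP y w) := fun x y => by
    simp [B]
  obtain ⟨f, hf0, hfV, hfw, hsum⟩ := exists_frame_of_posDef (n := n) (by simp) B
    (fun x y => by rw [hB, hB, lorIP_comm x y]; ring)
    (fun x hx => by rw [hB, ← pow_two]; exact lorIP_self_add_sq_pos hw hx) V hVj (w := w)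
    (by rw [hB, hw]; norm_num)
    (fun v hv => by rw [hB, hwV v hv, lorIP_comm v w, hwV v hv]; ring)
  simp only [hB] at hfw hsum
  have hfw' : ∀ i, lorIP (f i) w = if i = 0 then -1 else 0 := by
    intro i
    have := hfw i
    rw [hw] at this
    split_ifs at this ⊢ <;> linarith
  refine ⟨f, hfV, fun x y => ?_⟩
  have h := hsum x y
  have hterm : ∀ i, (lorIP x (f i) + 2 * (lorIP x w * lorIP (f i) w)) *
      (lorIP (f i) y + 2 * (lorIP (f i) w * lorIP y w)) = lorIP x (f i) * lorIP y (f i) := by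
    intro i
    rw [hfw', lorIP_comm (f i) y]
    split_ifs with hi
    · subst hi; rw [hf0]; ring
    · ring
  simp only [hterm] at h
  rw [hf0]
  linarith

/-- The composition `τ ∘ Ψ_j` of the Lorentzian indefinite fold with the inclusion into
`ℝ^{k+1}`. -/
def indefFold {j n : ℕ} (k : ℕ) (hjn : j < n) (x : Fin (n + 1) → ℝ) (i : Fin (k + 1)) : ℝ :=
  if h : (i : ℕ) < j then x ⟨(i : ℕ) + 1, by omega⟩
  else if (i : ℕ) = j then
    -x 0 ^ 2 + ∑ l : Fin (n + 1), if j + 1 ≤ (l : ℕ) then x l ^ 2 else 0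
  else 0

/-- The diffeomorphism of the target that straightens the family `s - 2 ℓ_i(a) + r_i`, where
`ℓ_0 = 0` and `ℓ_1, …, ℓ_j` are the coordinates of `a`. -/
lemma exists_straightening {j k : ℕ} (hjk : j < k) (Q : (Fin j → ℝ) → ℝ)
    (hQ : ContDiff ℝ (⊤ : ℕ∞) Q) (l : Fin (k + 1) → (Fin j → ℝ) → ℝ)
    (hl : ∀ i, ContDiff ℝ (⊤ : ℕ∞) (l i)) (r : Fin (k + 1) → ℝ) (hl0 : ∀ a, l 0 a = 0)
    (hlm : ∀ (m : Fin j) a, l ⟨m + 1, by omega⟩ a = a m) (hr : r 0 = 0) :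
    ∃ H : (Fin (k + 1) → ℝ) ≃ (Fin (k + 1) → ℝ),
      ContDiff ℝ (⊤ : ℕ∞) H ∧ ContDiff ℝ (⊤ : ℕ∞) H.symm ∧
      ∀ (s : ℝ) (a : Fin j → ℝ) (i : Fin (k + 1)), H (fun i => s - 2 * l i a + r i) i =
        if h : (i : ℕ) < j then a ⟨i, h⟩ else if (i : ℕ) = j then s - Q a else 0 := by
  let A : (Fin (k + 1) → ℝ) → Fin j → ℝ := fun y m =>
    (y 0 - y ⟨m + 1, by omega⟩ + r ⟨m + 1, by omega⟩) / 2
  let A' : (Fin (k + 1) → ℝ) → Fin j → ℝ := fun z m => z ⟨m, by omega⟩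
  let F : (Fin (k + 1) → ℝ) → Fin (k + 1) → ℝ := fun y i =>
    if h : (i : ℕ) < j then A y ⟨i, h⟩ else if (i : ℕ) = j then y 0 - Q (A y)
      else y i - (y 0 - 2 * l i (A y) + r i)
  let G : (Fin (k + 1) → ℝ) → Fin (k + 1) → ℝ := fun z i =>
    (z ⟨j, by omega⟩ + Q (A' z)) - 2 * l i (A' z) + r i + if j < (i : ℕ) then z i else 0
  have hA : ContDiff ℝ (⊤ : ℕ∞) A := by
    rw [contDiff_pi]; intro m; fun_prop
  have hA' : ContDiff ℝ (⊤ : ℕ∞) A' := by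
    rw [contDiff_pi]; intro m; fun_prop
  have hF : ContDiff ℝ (⊤ : ℕ∞) F := by
    rw [contDiff_pi]
    intro i
    have hli := hl i
    by_cases h : (i : ℕ) < j
    · simp only [F, dif_pos h]; fun_prop
    · by_cases h' : (i : ℕ) = j
      · simp only [F, dif_neg h, if_pos h']; fun_prop
      · simp only [F, dif_neg h, if_neg h']; fun_prop
  have hG : ContDiff ℝ (⊤ : ℕ∞) G := by
    rw [contDiff_pi]
    intro i
    have hli := hl i
    by_cases h : j < (i : ℕ)
    · simp only [G, if_pos h]; fun_prop
    · simp only [G, if_neg h]; fun_prop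
  have hA'F : ∀ y, A' (F y) = A y := fun y => by
    funext m; simp only [A', F, dif_pos m.2]
  have hAform : ∀ (s : ℝ) (a : Fin j → ℝ) (y : Fin (k + 1) → ℝ),
      (∀ i : Fin (k + 1), (i : ℕ) ≤ j → y i = s - 2 * l i a + r i) → A y = a := by
    intro s a y hy
    funext m
    simp only [A]
    rw [hy 0 (Nat.zero_le j), hy _ (Nat.succ_le_of_lt m.2), hl0, hlm, hr]; ring
  have hAG : ∀ z, A (G z) = A' z := fun z => by
    refine hAform (z ⟨j, by omega⟩ + Q (A' z)) _ _ fun i hi => ?_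
    simp only [G, if_neg (not_lt.2 hi), add_zero]
  have hG0 : ∀ z, G z 0 = z ⟨j, by omega⟩ + Q (A' z) := fun z => by
    simp [G, hl0, hr]
  refine ⟨⟨F, G, fun y => ?_, fun z => ?_⟩, hF, hG, fun s a i => ?_⟩
  · have hFj : F y ⟨j, by omega⟩ = y 0 - Q (A y) := by simp [F]
    funext i
    simp only [G, hA'F, hFj]
    by_cases hi : j < (i : ℕ)
    · have : F y i = y i - (y 0 - 2 * l i (A y) + r i) := by
        simp only [F, dif_neg hi.not_gt, if_neg hi.ne']
      rw [if_pos hi, this]; ring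
    · rw [if_neg hi]
      obtain ⟨i, hik⟩ := i
      cases i with
      | zero =>
        change y 0 - Q (A y) + Q (A y) - 2 * l 0 (A y) + r 0 + 0 = y 0
        rw [hl0, hr]; ring
      | succ m =>
        have := hlm ⟨m, by simp at hi; omega⟩ (A y)
        simp only at this
        rw [this]
        simp only [A]; ring
  · funext i
    by_cases h : (i : ℕ) < j
    · simp only [F, dif_pos h, hAG, A']
    · by_cases h' : (i : ℕ) = j
      · simp only [F, dif_neg h, if_pos h', hAG, hG0]
        rw [show i = ⟨j, by omega⟩ from Fin.ext h']; ring
      · simp only [F, dif_neg h, if_neg h', hAG, hG0]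
        simp only [G, if_pos (show j < (i : ℕ) by omega)]; ring
  · have hAs : A (fun i => s - 2 * l i a + r i) = a := hAform s a _ fun i _ => rfl
    simp only [Equiv.coe_fn_mk, F, hAs, hl0, hr]
    split_ifs <;> ring

lemma recSubUpTo_eq_span {n k j : ℕ} (hjk : j < k) (p : Fin (k + 1) → Fin (n + 1) → ℝ) :
    recSubUpTo p j =
      Submodule.span ℝ (Set.range fun m : Fin j => p ⟨m + 1, by omega⟩ - p 0) := by
  refine le_antisymm (Submodule.span_le.2 ?_) (Submodule.span_mono ?_)
  · rintro v ⟨⟨i, hik⟩, hi, rfl⟩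
    cases i with
    | zero => change p 0 - p 0 ∈ _; rw [sub_self]; exact Submodule.zero_mem _
    | succ m => exact Submodule.subset_span ⟨⟨m, hi⟩, rfl⟩
  · rintro v ⟨m, rfl⟩
    exact ⟨_, Nat.succ_le_of_lt m.2, rfl⟩

lemma recSub_eq_recSubUpTo {n k j : ℕ} (p : Fin (k + 1) → Fin (n + 1) → ℝ)
    (h1 : Module.finrank ℝ (recSubUpTo p j) = j) (h2 : Module.finrank ℝ (recSub p) = j) :
    recSub p = recSubUpTo p j := by
  symm
  refine Submodule.eq_of_le_of_finrank_eq (Submodule.span_mono ?_) (h1.trans h2.symm)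
  rintro v ⟨i, -, rfl⟩
  exact ⟨i, rfl⟩

lemma aEquiv_indefFold_of_spaceLike {j k n : ℕ} (hjn : j < n) (hjk : j < k)
    (p : Fin (k + 1) → Fin (n + 1) → ℝ) (h1 : Module.finrank ℝ (recSubUpTo p j) = j)
    (h2 : Module.finrank ℝ (recSub p) = j) (hV : LSpaceLike (recSub p)) :
    AEquiv (LorDSM p) (indefFold k hjn) := by
  obtain ⟨f, hfV, hf⟩ := exists_lorentz_frame hV h2
  let v : Fin j → Fin (n + 1) → ℝ := fun m => p ⟨m + 1, by omega⟩ - p 0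
  have hspan : ∀ u ∈ recSub p, ∃ c : Fin j → ℝ, ∑ m, c m • v m = u := fun u hu => by
    rw [recSub_eq_recSubUpTo p h1 h2, recSubUpTo_eq_span hjk p] at hu
    exact (Submodule.mem_span_range_iff_exists_fun ℝ).1 hu
  have hC : ∀ i : Fin (n + 1), ∃ c : Fin j → ℝ,
      1 ≤ (i : ℕ) → (i : ℕ) ≤ j → ∑ m, c m • v m = f i := by
    intro i
    by_cases h : 1 ≤ (i : ℕ) ∧ (i : ℕ) ≤ j
    · obtain ⟨c, hc⟩ := hspan _ (hfV i h.1 h.2)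
      exact ⟨c, fun _ _ => hc⟩
    · exact ⟨0, fun a b => absurd ⟨a, b⟩ h⟩
  choose C hC using hC
  have hD : ∀ i : Fin (k + 1), ∃ d : Fin j → ℝ, ∑ m, d m • v m = p i - p 0 ∧
      (i = 0 → d = 0) ∧ ∀ m : Fin j, i = ⟨m + 1, by omega⟩ → d = Pi.single m 1 := by
    rintro ⟨i, hik⟩
    cases i with
    | zero =>
      refine ⟨0, ?_, fun _ => rfl, fun m hm => by simp at hm⟩
      change _ = p 0 - p 0
      simp
    | succ i =>
      by_cases hi : i < j
      · refine ⟨Pi.single ⟨i, hi⟩ 1, ?_, fun h => by simp [Fin.ext_iff] at h, fun m hm => ?_⟩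
        · simp [Pi.single_apply, ite_smul, v]
        · congr 1
          simp only [Fin.mk.injEq, Nat.add_right_cancel_iff] at hm
          exact Fin.ext hm
      · obtain ⟨d, hd⟩ := hspan (p ⟨i + 1, hik⟩ - p 0) (Submodule.subset_span ⟨_, rfl⟩)
        refine ⟨d, hd, fun h => by simp [Fin.ext_iff] at h, fun m hm => ?_⟩
        simp only [Fin.mk.injEq, Nat.add_right_cancel_iff] at hm
        exact absurd m.2 (hm ▸ hi)
  choose D hDsum hD0 hDm using hD
  let Q : (Fin j → ℝ) → ℝ := fun a =>
    ∑ i : Fin (n + 1), if 1 ≤ (i : ℕ) ∧ (i : ℕ) ≤ j then (∑ m, C i m * a m) ^ 2 else 0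
  have hQ : ContDiff ℝ (⊤ : ℕ∞) Q := by
    refine ContDiff.sum fun i _ => ?_
    by_cases h : 1 ≤ (i : ℕ) ∧ (i : ℕ) ≤ j
    · simp only [if_pos h]; fun_prop
    · simp only [if_neg h]; fun_prop
  obtain ⟨H, hH, hH', hHform⟩ := exists_straightening hjk Q hQ (fun i a => ∑ m, D i m * a m)
    (fun i => by fun_prop) (fun i => lorIP (p i - p 0) (p i - p 0))
    (fun a => by simp [hD0 0 rfl])
    (fun m a => by simp [hDm _ m rfl, Pi.single_apply])
    (by simp [lorIP])
  let g : Fin (n + 1) → Fin (n + 1) → ℝ := fun i =>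
    if h : 1 ≤ (i : ℕ) ∧ (i : ℕ) ≤ j then v ⟨i - 1, by omega⟩ else f i
  let M : (Fin (n + 1) → ℝ) →ₗ[ℝ] (Fin (n + 1) → ℝ) :=
    LinearMap.pi fun i => (lorBilin n).flip (g i)
  have hM : ∀ z i, M z i = lorIP z (g i) := fun z i => rfl
  have hMv : ∀ z (m : Fin j), M z ⟨m + 1, by omega⟩ = lorIP z (v m) := fun z m => by
    rw [hM]
    simp only [g]
    rw [dif_pos ⟨by omega, m.2⟩]
    rfl
  have hMf : ∀ z (i : Fin (n + 1)), ¬ (1 ≤ (i : ℕ) ∧ (i : ℕ) ≤ j) → M z i = lorIP z (f i) :=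
    fun z i hi => by rw [hM]; simp only [g, dif_neg hi]
  have hfC : ∀ z (i : Fin (n + 1)), 1 ≤ (i : ℕ) → (i : ℕ) ≤ j →
      lorIP z (f i) = ∑ m, C i m * lorIP z (v m) := fun z i hi hi' => by
    rw [← hC i hi hi', lorIP_sum_smul_right]
  have hMinj : Function.Injective M := by
    rw [← LinearMap.ker_eq_bot, LinearMap.ker_eq_bot']
    intro z hz
    have hzf : ∀ i, lorIP z (f i) = 0 := fun i => by
      by_cases hi : 1 ≤ (i : ℕ) ∧ (i : ℕ) ≤ j
      · rw [hfC z i hi.1 hi.2]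
        refine Finset.sum_eq_zero fun m _ => ?_
        rw [← hMv, hz, Pi.zero_apply, mul_zero]
      · rw [← hMf z i hi, hz, Pi.zero_apply]
    refine lorIP_left_eq_zero fun y => ?_
    rw [hf]
    simp [hzf]
  have hself : ∀ z, lorIP z z = Q (fun m => lorIP z (v m)) +
      (-M z 0 ^ 2 + ∑ l : Fin (n + 1), if j + 1 ≤ (l : ℕ) then M z l ^ 2 else 0) := fun z => by
    have hterm : ∀ i : Fin (n + 1), lorIP z (f i) * lorIP z (f i) =
        (if 1 ≤ (i : ℕ) ∧ (i : ℕ) ≤ j then (∑ m, C i m * lorIP z (v m)) ^ 2 else 0) +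
        (if j + 1 ≤ (i : ℕ) then M z i ^ 2 else 0) +
        if i = 0 then lorIP z (f 0) ^ 2 else 0 := by
      intro i
      by_cases hi0 : i = 0
      · subst hi0
        simp; ring
      · have hi1 : 1 ≤ (i : ℕ) := Nat.one_le_iff_ne_zero.2 fun h => hi0 (Fin.ext h)
        by_cases hi : (i : ℕ) ≤ j
        · rw [if_pos ⟨hi1, hi⟩, if_neg (by omega), if_neg hi0, ← hfC z i hi1 hi]; ring
        · rw [if_neg (by omega), if_pos (by omega), if_neg hi0, hMf z i (by omega)]; ring
    rw [hf z z, Finset.sum_congr rfl fun i _ => hterm i, Finset.sum_add_distrib,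
      Finset.sum_add_distrib, Finset.sum_ite_eq' Finset.univ, if_pos (Finset.mem_univ _),
      hMf z 0 (by simp)]
    ring
  let e : (Fin (n + 1) → ℝ) ≃L[ℝ] (Fin (n + 1) → ℝ) :=
    (LinearEquiv.ofInjectiveEndo M hMinj).toContinuousLinearEquiv
  have he : ∀ z, e z = M z := fun z => rfl
  refine ⟨e.symm.toEquiv.trans (Equiv.addRight (p 0)), H, ?_, ?_, hH, hH', ?_⟩
  · exact e.symm.contDiff.add contDiff_const
  · exact e.contDiff.comp (contDiff_id.add contDiff_const)
  · funext x i
    obtain ⟨z, rfl⟩ := e.surjective x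
    have hL : LorDSM p (z + p 0) = fun i => lorIP z z - 2 * (∑ m, D i m * lorIP z (v m)) +
        lorIP (p i - p 0) (p i - p 0) := by
      funext i
      rw [LorDSM, show z + p 0 - p i = z - (p i - p 0) by abel, lorIP_sub_self,
        ← lorIP_sum_smul_right, hDsum]
    have hx : (e.symm.toEquiv.trans (Equiv.addRight (p 0))) (e z) = z + p 0 := by
      simp
    rw [Function.comp_apply, Function.comp_apply, hx, hL, hHform, indefFold, he]
    split_ifs with h h'
    · exact hMv z ⟨i, h⟩
    · rw [hself z]; ring
    · rfl

lemma differentiable_lorDSM {n m : ℕ} (p : Fin m → Fin (n + 1) → ℝ) :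
    Differentiable ℝ (LorDSM p) := by
  rw [differentiable_pi]
  intro i
  simp only [LorDSM, lorIP, Pi.sub_apply]
  fun_prop

lemma fderiv_lorDSM_apply {n m : ℕ} (p : Fin m → Fin (n + 1) → ℝ) (x w : Fin (n + 1) → ℝ)
    (i : Fin m) : fderiv ℝ (LorDSM p) x w i = 2 * lorIP (x - p i) w := by
  have h1 := hasDerivAt_pi.1 ((differentiable_lorDSM p x).hasFDerivAt.hasLineDerivAt w) i
  have h2 : HasDerivAt (fun t : ℝ => LorDSM p (x + t • w) i) (2 * lorIP (x - p i) w) 0 := by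
    have e : (fun t : ℝ => LorDSM p (x + t • w) i) = fun t : ℝ =>
        lorIP (x - p i) (x - p i) + t * (2 * lorIP (x - p i) w) + t ^ 2 * lorIP w w := by
      funext t
      rw [LorDSM, show x + t • w - p i = (x - p i) - (-t) • w by module, lorIP_sub_self,
        lorIP_smul_left, lorIP_smul_right, lorIP_smul_right]
      ring
    rw [e]
    have := (((hasDerivAt_id (0 : ℝ)).mul_const (2 * lorIP (x - p i) w)).const_add
      (lorIP (x - p i) (x - p i))).fun_add
      (((hasDerivAt_id (0 : ℝ)).fun_pow 2).mul_const (lorIP w w))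
    simpa using this
  exact h1.unique h2

lemma differentiable_indefFold {j n : ℕ} (k : ℕ) (hjn : j < n) :
    Differentiable ℝ (indefFold k hjn) := by
  rw [differentiable_pi]
  intro i
  simp only [indefFold]
  split_ifs
  · fun_prop
  · refine Differentiable.add (by fun_prop) (Differentiable.fun_sum fun l _ => ?_)
    split_ifs <;> fun_prop
  · fun_prop

/-- The fold has full rank at every point with nonzero time coordinate. -/
lemma exists_fderiv_indefFold_eq {j k n : ℕ} (hjn : j < n) (hjk : j < k)
    {y : Fin (n + 1) → ℝ} (hy : y 0 ≠ 0) (c : Fin (j + 1) → ℝ) :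
    ∃ w, ∀ i : Fin (j + 1), fderiv ℝ (indefFold k hjn) y w ⟨i, by omega⟩ = c i := by
  let w : Fin (n + 1) → ℝ := fun l =>
    if l = 0 then -c (Fin.last j) / (2 * y 0)
    else if h : (l : ℕ) ≤ j then c ⟨l - 1, by omega⟩ else 0
  have hw0 : w 0 = -c (Fin.last j) / (2 * y 0) := if_pos rfl
  refine ⟨w, fun i => ?_⟩
  have h1 := hasDerivAt_pi.1
    ((differentiable_indefFold k hjn y).hasFDerivAt.hasLineDerivAt w) ⟨i, by omega⟩
  refine h1.unique ?_
  by_cases hi : (i : ℕ) < j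
  · have hwi : w ⟨i + 1, by omega⟩ = c i := by
      simp only [w]
      rw [if_neg (Fin.ne_of_val_ne (Nat.succ_ne_zero _)), dif_pos (by simpa using hi)]
      rfl
    simp only [indefFold, dif_pos hi, Pi.add_apply, Pi.smul_apply, hwi, smul_eq_mul]
    simpa using ((hasDerivAt_id (0 : ℝ)).mul_const (c i)).const_add (y ⟨i + 1, by omega⟩)
  · have hij : (i : ℕ) = j := by omega
    have hwl : ∀ (t : ℝ) (l : Fin (n + 1)),
        (if j + 1 ≤ (l : ℕ) then (y l + t * w l) ^ 2 else 0) =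
          if j + 1 ≤ (l : ℕ) then y l ^ 2 else 0 := fun t l => by
      split_ifs with hl
      · have : w l = 0 := by
          simp only [w]
          rw [if_neg (by rintro rfl; simp at hl), dif_neg (by omega)]
        rw [this, mul_zero, add_zero]
      · rfl
    simp only [indefFold, dif_neg hi, if_pos hij, Pi.add_apply, Pi.smul_apply, smul_eq_mul, hwl]
    have h := ((((hasDerivAt_id (0 : ℝ)).mul_const (w 0)).const_add
      (y 0)).fun_pow 2).fun_neg.add_const (∑ l : Fin (n + 1), if j + 1 ≤ (l : ℕ) then y l ^ 2 else 0)
    have hval : -(2 * (y 0 + 0 * w 0) ^ (2 - 1) * (1 * w 0)) = c i := by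
      rw [hw0, show i = Fin.last j from Fin.ext hij]
      norm_num
      field_simp
    exact hval ▸ h

/-- Every fibre of the fold contains a point with nonzero time coordinate. -/
lemma exists_indefFold_eq {j n : ℕ} (k : ℕ) (hjn : j < n) (x : Fin (n + 1) → ℝ) :
    ∃ y : Fin (n + 1) → ℝ, y 0 ≠ 0 ∧ indefFold k hjn y = indefFold k hjn x := by
  set c : ℝ := -x 0 ^ 2 + ∑ l : Fin (n + 1), if j + 1 ≤ (l : ℕ) then x l ^ 2 else 0 with hc
  have ht : 0 < 1 + |c| := by positivity
  have hs : 0 ≤ c + 1 + |c| := by linarith [neg_abs_le c]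
  let y : Fin (n + 1) → ℝ := fun l =>
    if l = 0 then Real.sqrt (1 + |c|) else if (l : ℕ) ≤ j then x l
      else if (l : ℕ) = j + 1 then Real.sqrt (c + 1 + |c|) else 0
  have hy0 : y 0 = Real.sqrt (1 + |c|) := if_pos rfl
  refine ⟨y, by rw [hy0]; exact (Real.sqrt_pos.2 ht).ne', ?_⟩
  have hsum : ∀ l : Fin (n + 1), (if j + 1 ≤ (l : ℕ) then y l ^ 2 else 0) =
      if l = ⟨j + 1, by omega⟩ then c + 1 + |c| else 0 := fun l => by
    by_cases hl : j + 1 ≤ (l : ℕ)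
    · have hl0 : l ≠ 0 := by rintro rfl; simp at hl
      rw [if_pos hl]
      simp only [y, if_neg hl0, if_neg (show ¬ (l : ℕ) ≤ j by omega)]
      by_cases hl' : (l : ℕ) = j + 1
      · rw [if_pos hl', if_pos (Fin.ext hl'), Real.sq_sqrt hs]
      · rw [if_neg hl', if_neg (fun h => hl' (congrArg Fin.val h)), zero_pow two_ne_zero]
    · rw [if_neg hl, if_neg (by rintro rfl; simp at hl)]
  funext i
  simp only [indefFold]
  split_ifs with h h'
  · simp only [y]
    rw [if_neg (Fin.ne_of_val_ne (Nat.succ_ne_zero _)), if_pos (by simpa using h)]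
  · rw [← hc, Finset.sum_congr rfl fun l _ => hsum l, Finset.sum_ite_eq' Finset.univ,
      if_pos (Finset.mem_univ _), hy0, Real.sq_sqrt ht.le]
    ring
  · rfl

lemma spaceLike_of_aEquiv_indefFold {j k n : ℕ} (hjn : j < n) (hjk : j < k)
    (p : Fin (k + 1) → Fin (n + 1) → ℝ) (h2 : Module.finrank ℝ (recSub p) = j)
    (hA : AEquiv (LorDSM p) (indefFold k hjn)) : LSpaceLike (recSub p) := by
  intro v hv hv0
  by_contra! hvv
  obtain ⟨h, H, hh, -, hH, -, hfold⟩ := hA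
  obtain ⟨y, hy0, hy⟩ := exists_indefFold_eq k hjn (h.symm (p 0))
  have hfib : LorDSM p (h y) = LorDSM p (p 0) := by
    rw [hfold] at hy
    simpa using hy
  have hmem : ∀ i, p i - p 0 ∈ recSub p := fun i => Submodule.subset_span ⟨i, rfl⟩
  have hnull : lorIP (h y - p 0) (h y - p 0) = 0 := by
    have := congr_fun hfib 0
    simpa [LorDSM, lorIP] using this
  have horth : ∀ u ∈ recSub p, lorIP (h y - p 0) u = 0 := by
    suffices recSub p ≤ LinearMap.ker (lorBilin n (h y - p 0)) from fun u hu => this hu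
    refine Submodule.span_le.2 ?_
    rintro u ⟨i, rfl⟩
    change lorIP (h y - p 0) (p i - p 0) = 0
    have := congr_fun hfib i
    rw [LorDSM, LorDSM, show h y - p i = (h y - p 0) - (p i - p 0) by abel,
      show p 0 - p i = 0 - (p i - p 0) by abel, lorIP_sub_self (h y - p 0), lorIP_sub_self 0,
      hnull] at this
    have hz : ∀ u : Fin (n + 1) → ℝ, lorIP 0 u = 0 := fun u => by simp [lorIP]
    rw [hz, hz] at this
    linarith
  have hx : h y - p 0 ∈ recSub p := by
    rw [eq_smul_of_lorIP_eq_zero hnull.le hvv hv0 (horth v hv)]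
    exact Submodule.smul_mem _ _ hv
  have hxi : ∀ i, h y - p i ∈ recSub p := fun i => by
    rw [show h y - p i = (h y - p 0) - (p i - p 0) by abel]
    exact Submodule.sub_mem _ hx (hmem i)
  -- The derivative of the distance-squared mapping at `h y` factors through the dual of `recSub p`.
  let B : (Fin (n + 1) → ℝ) →ₗ[ℝ] Module.Dual ℝ (recSub p) :=
    ((lorBilin n).domRestrict (recSub p)).flip
  let A : Module.Dual ℝ (recSub p) →ₗ[ℝ] (Fin (k + 1) → ℝ) :=
    LinearMap.pi fun i => (2 : ℝ) • Module.Dual.eval ℝ (recSub p) ⟨h y - p i, hxi i⟩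
  have hAB : ∀ w, fderiv ℝ (LorDSM p) (h y) w = A (B w) := fun w => by
    funext i
    rw [fderiv_lorDSM_apply]
    rfl
  have hchain : ∀ w, fderiv ℝ (indefFold k hjn) y w =
      fderiv ℝ H (LorDSM p (h y)) (A (B (fderiv ℝ h y w))) := fun w => by
    have dh : DifferentiableAt ℝ h y := hh.differentiable (by simp) y
    have dH : DifferentiableAt ℝ H (LorDSM p (h y)) := hH.differentiable (by simp) _
    have hd := dH.hasFDerivAt.comp y
      ((differentiable_lorDSM p (h y)).hasFDerivAt.comp y dh.hasFDerivAt)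
    rw [← hAB, hfold, hd.fderiv]
    rfl
  let P : Module.Dual ℝ (recSub p) →ₗ[ℝ] (Fin (j + 1) → ℝ) :=
    (LinearMap.funLeft ℝ ℝ fun i : Fin (j + 1) => (⟨i, by omega⟩ : Fin (k + 1))) ∘ₗ
      (fderiv ℝ H (LorDSM p (h y))).toLinearMap ∘ₗ A
  have hP : Function.Surjective P := fun c => by
    obtain ⟨w, hw⟩ := exists_fderiv_indefFold_eq hjn hjk hy0 c
    refine ⟨B (fderiv ℝ h y w), funext fun i => ?_⟩
    rw [← hw i, hchain w]
    rfl
  have := LinearMap.finrank_le_finrank_of_surjective hP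
  rw [Subspace.dual_finrank_eq, h2, Module.finrank_fin_fun] at this
  omega

theorem theorem4_1b (j k n : ℕ) (hj : 1 ≤ j) (hjn : j < n) (hjk : j < k)
    (p : Fin (k + 1) → Fin (n + 1) → ℝ)
    (h1 : Module.finrank ℝ (recSubUpTo p j) = j)
    (h2 : Module.finrank ℝ (recSub p) = j) :
    AEquiv (LorDSM p)
        (fun (x : Fin (n + 1) → ℝ) (i : Fin (k + 1)) =>
          if h : (i : ℕ) < j then x ⟨(i : ℕ) + 1, by omega⟩
          else if (i : ℕ) = j then
            -x 0 ^ 2 + ∑ l : Fin (n + 1), if j + 1 ≤ (l : ℕ) then x l ^ 2 else 0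
          else 0)
      ↔ LSpaceLike (recSub p) := by
  exact ⟨spaceLike_of_aEquiv_indefFold hjn hjk p h2,
    aEquiv_indefFold_of_spaceLike hjn hjk p h1 h2⟩
end
end

section
/- Let j, k, n be positive integers with j < n and j < k, and let p₀,…,p_k ∈ ℝ^{1,n} be (k+1) points such that dim V(p₀,…,p_j) = dim V(p₀,…,p_k) = j. Then the Lorentzian distance-squared mapping L_{(p₀,…,p_k)} : ℝ^{1,n} → ℝ^{k+1} is A-equivalent to the mapping (x₀,…,xₙ) ↦ (x₁,…,x_j, x₀x₁ + Σ_{i=j+1}^n x_i², 0,…,0) if and only if the recognition subspace V(p₀,…,p_k) is light-like. -/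
open scoped BigOperators

noncomputable section

/-- The Lorentzian inner product as a bilinear form. -/
def lorForm (n : ℕ) : LinearMap.BilinForm ℝ (Fin (n + 1) → ℝ) :=
  LinearMap.mk₂ ℝ lorIP
    (fun x x' y => by simp only [lorIP, Pi.add_apply, add_mul, Finset.sum_add_distrib]; ring)
    (fun c x y => by
      simp only [lorIP, Pi.smul_apply, smul_eq_mul, mul_assoc, ← Finset.mul_sum]; ring)
    (fun x y y' => by simp only [lorIP, Pi.add_apply, mul_add, Finset.sum_add_distrib]; ring)
    (fun c x y => by
      simp only [lorIP, Pi.smul_apply, smul_eq_mul, mul_left_comm _ c, ← Finset.mul_sum]; ring)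

lemma lorForm_apply {n : ℕ} (x y : Fin (n + 1) → ℝ) : lorForm n x y = lorIP x y := rfl

lemma lorIP_eq_succ {n : ℕ} (x y : Fin (n + 1) → ℝ) :
    lorIP x y = (∑ i : Fin n, x i.succ * y i.succ) - x 0 * y 0 := by
  rw [lorIP, Fin.sum_univ_succ]; ring

lemma lorForm_isRefl (n : ℕ) : (lorForm n).IsRefl := fun x y h => by
  rw [lorForm_apply] at *; rwa [lorIP_comm]

lemma lorForm_nondegenerate (n : ℕ) : (lorForm n).Nondegenerate := by
  refine (lorForm_isRefl n).nondegenerate_iff_separatingLeft.2 fun x hx => ?_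
  funext i
  have h := hx (Pi.single i 1)
  rw [lorForm_apply] at h
  cases i using Fin.cases with
  | zero => simpa [lorIP_eq_succ] using h
  | succ i => simpa [lorIP_eq_succ, Pi.single_apply] using h

lemma lorIP_self_of_time_eq_zero {n : ℕ} {x : Fin (n + 1) → ℝ} (h0 : x 0 = 0) :
    0 ≤ lorIP x x ∧ (lorIP x x = 0 → x = 0) := by
  rw [lorIP_eq_succ, h0]
  have hnn : ∀ i ∈ Finset.univ, 0 ≤ x (Fin.succ i) * x (Fin.succ i) :=
    fun i _ => mul_self_nonneg _
  refine ⟨by simpa using Finset.sum_nonneg hnn, fun h => ?_⟩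
  have h' := (Finset.sum_eq_zero_iff_of_nonneg hnn).1 (by simpa using h)
  funext i
  cases i using Fin.cases with
  | zero => exact h0
  | succ i => simpa using h' i (Finset.mem_univ _)

/-- A vector orthogonal to a time-like vector and of non-positive square vanishes. -/
lemma eq_zero_of_orthogonal_timelike {n : ℕ} {u v : Fin (n + 1) → ℝ} (hv : lorIP v v < 0)
    (huv : lorIP u v = 0) (hu : lorIP u u ≤ 0) : u = 0 := by
  have h0 : u 0 = 0 := by
    by_contra hne
    have hpos : 0 < u 0 ^ 2 := by positivity
    rw [lorIP_eq_succ] at hv huv hu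
    have hcs := Finset.sum_mul_sq_le_sq_mul_sq Finset.univ (fun i : Fin n => u i.succ)
      (fun i => v i.succ)
    simp only [pow_two] at hcs hpos
    rw [sub_eq_zero.1 huv] at hcs
    have hnn : 0 ≤ ∑ i : Fin n, v i.succ * v i.succ :=
      Finset.sum_nonneg fun i _ => mul_self_nonneg _
    nlinarith
  obtain ⟨h1, h2⟩ := lorIP_self_of_time_eq_zero h0
  exact h2 (le_antisymm hu h1)

lemma LorDSM_apply {n m : ℕ} (p : Fin m → Fin (n + 1) → ℝ) (q x : Fin (n + 1) → ℝ) (i : Fin m) :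
    LorDSM p x i
      = lorIP (x - q) (x - q) - 2 * lorIP (x - q) (p i - q) + lorIP (p i - q) (p i - q) := by
  have h : x - p i = (x - q) - (p i - q) := by abel
  simp only [LorDSM, ← lorForm_apply]
  rw [h]
  generalize x - q = y
  generalize p i - q = r
  have := lorIP_comm r y
  simp only [map_sub, LinearMap.sub_apply, lorForm_apply] at *
  linarith

lemma HasDerivAt.lorIP_self {n : ℕ} {c : ℝ → Fin (n + 1) → ℝ} {c' : Fin (n + 1) → ℝ} {t : ℝ}
    (hc : HasDerivAt c c' t) :
    HasDerivAt (fun s => lorIP (c s) (c s)) (2 * lorIP (c t) c') t := by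
  have hi := hasDerivAt_pi.1 hc
  have := (HasDerivAt.fun_sum fun i (_ : i ∈ Finset.univ) => (hi i).mul (hi i)).sub
    (((hi 0).mul (hi 0)).const_mul 2)
  refine this.congr_deriv ?_
  simp only [lorIP, mul_sub, Finset.mul_sum]
  congr 1
  · exact Finset.sum_congr rfl fun i _ => by ring
  · ring

lemma lorIP_eq_zero_of_mem_span {n : ℕ} {s : Set (Fin (n + 1) → ℝ)} {y : Fin (n + 1) → ℝ}
    (h : ∀ v ∈ s, lorIP y v = 0) : ∀ v ∈ Submodule.span ℝ s, lorIP y v = 0 :=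
  fun _ hv => (Submodule.span_le (p := LinearMap.ker (lorForm n y))).2 h hv

/-- If `y - p_i` is orthogonal to `M` for all `i`, where `M` has at least the dimension
complementary to that of `V(p₀, …, p_k)`, then `y - p₀` lies in `V(p₀, …, p_k)`. -/
lemma sub_mem_recSub {n k : ℕ} (p : Fin (k + 1) → Fin (n + 1) → ℝ)
    (y : Fin (n + 1) → ℝ) (M : Submodule ℝ (Fin (n + 1) → ℝ))
    (hM : n + 1 ≤ Module.finrank ℝ M + Module.finrank ℝ (recSub p))
    (hy : ∀ v ∈ M, ∀ i, lorIP (y - p i) v = 0) : y - p 0 ∈ recSub p := by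
  have hle : M ≤ (lorForm n).orthogonal (recSub p) := by
    intro v hv w hw
    change lorIP w v = 0
    rw [lorIP_comm]
    refine lorIP_eq_zero_of_mem_span ?_ w hw
    rintro _ ⟨i, rfl⟩
    have h : p i - p 0 = (y - p 0) - (y - p i) := by abel
    simp only
    rw [lorIP_comm, ← lorForm_apply, h, map_sub, LinearMap.sub_apply, lorForm_apply,
      lorForm_apply, hy v hv, hy v hv, sub_zero]
  have heq : M = (lorForm n).orthogonal (recSub p) := by
    refine Submodule.eq_of_le_of_finrank_le hle ?_
    rw [LinearMap.BilinForm.finrank_orthogonal (lorForm_nondegenerate n), Module.finrank_fin_fun]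
    omega
  rw [← LinearMap.BilinForm.orthogonal_orthogonal (lorForm_nondegenerate n) (lorForm_isRefl n)
    (recSub p), ← heq]
  intro v hv
  change lorIP v (y - p 0) = 0
  rw [lorIP_comm]
  exact hy v hv 0

/-- A point `x` at which `g = H ∘ L_p ∘ h` is stationary along a subspace `K` of complementary
dimension is carried by `h` into `p₀ + V(p₀, …, p_k)`. -/
lemma apply_sub_mem_recSub {n k : ℕ} (p : Fin (k + 1) → Fin (n + 1) → ℝ)
    (g : (Fin (n + 1) → ℝ) → Fin (k + 1) → ℝ)
    (h : (Fin (n + 1) → ℝ) ≃ (Fin (n + 1) → ℝ)) (H : (Fin (k + 1) → ℝ) ≃ (Fin (k + 1) → ℝ))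
    (hh : Differentiable ℝ h) (hh' : Differentiable ℝ h.symm) (hH' : Differentiable ℝ H.symm)
    (hg : g = H ∘ LorDSM p ∘ h) (x : Fin (n + 1) → ℝ) (K : Submodule ℝ (Fin (n + 1) → ℝ))
    (hK : n + 1 ≤ Module.finrank ℝ K + Module.finrank ℝ (recSub p))
    (hgK : ∀ v ∈ K, HasDerivAt (fun t : ℝ => g (x + t • v)) 0 0) :
    h x - p 0 ∈ recSub p := by
  set D := fderiv ℝ h x
  have hD : HasFDerivAt h D x := (hh x).hasFDerivAt
  have hinj : Function.Injective D := by
    have hcomp := ((hh' (h x)).hasFDerivAt).comp x hD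
    have hid : h.symm ∘ h = id := by funext z; simp
    rw [hid] at hcomp
    have huniq := hcomp.unique (hasFDerivAt_id x)
    intro a b hab
    have ha := congrArg (fun L => L a) huniq
    have hb := congrArg (fun L => L b) huniq
    simp only [ContinuousLinearMap.comp_apply, ContinuousLinearMap.id_apply] at ha hb
    rw [← ha, ← hb, hab]
  refine sub_mem_recSub p (h x) (K.map (D : (Fin (n + 1) → ℝ) →ₗ[ℝ] _)) ?_ ?_
  · rwa [← (K.equivMapOfInjective _ hinj).finrank_eq]
  rintro _ ⟨v, hv, rfl⟩ i
  have hline : HasDerivAt (fun t : ℝ => x + t • v) v 0 := by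
    simpa using ((hasDerivAt_id (0 : ℝ)).smul_const v).const_add x
  have hhl : HasDerivAt (fun t : ℝ => h (x + t • v) - p i) (D v) 0 := by
    refine HasDerivAt.sub_const _ ?_
    exact HasFDerivAt.comp_hasDerivAt (f := fun t : ℝ => x + t • v) (0 : ℝ) (by simpa using hD) hline
  have hF := hhl.lorIP_self
  have hF0 : HasDerivAt (fun t : ℝ => LorDSM p (h (x + t • v))) 0 0 := by
    have hc := HasFDerivAt.comp_hasDerivAt (f := fun t : ℝ => g (x + t • v)) (0 : ℝ)
      (hH' _).hasFDerivAt (hgK v hv)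
    have heq : (H.symm ∘ fun t : ℝ => g (x + t • v)) = fun t : ℝ => LorDSM p (h (x + t • v)) := by
      funext t; simp [hg]
    rw [heq] at hc
    simpa using hc
  have huniq := hF.unique (hasDerivAt_pi.1 hF0 i)
  simpa using huniq

/-- Membership of a nonzero vector in the radical of `V` makes `V` light-like. -/
lemma LLightLike_of_radical {n : ℕ} {V : Submodule ℝ (Fin (n + 1) → ℝ)} {u : Fin (n + 1) → ℝ}
    (hu : u ∈ V) (hu0 : u ≠ 0) (horth : ∀ v ∈ V, lorIP u v = 0) : LLightLike V := by
  refine ⟨?_, fun hs => (hs u hu hu0).ne' (horth u hu)⟩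
  rintro ⟨v, hv, hneg⟩
  exact hu0 (eq_zero_of_orthogonal_timelike hneg (horth v hv) (horth u hu).le)

/-- The normal form `(x₁, …, x_j, x₀x₁ + ∑_{i > j} x_i², 0, …, 0)`. -/
def lightNormalForm (j k n : ℕ) (hj : 1 ≤ j) (hjn : j < n)
    (x : Fin (n + 1) → ℝ) (i : Fin (k + 1)) : ℝ :=
  if h : (i : ℕ) < j then x ⟨(i : ℕ) + 1, by omega⟩
  else if (i : ℕ) = j then
    x 0 * x ⟨1, by omega⟩
      + ∑ l : Fin (n + 1), if j + 1 ≤ (l : ℕ) then x l ^ 2 else 0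
  else 0

lemma LLightLike_of_AEquiv {j k n : ℕ} (hj : 1 ≤ j) (hjn : j < n)
    (p : Fin (k + 1) → Fin (n + 1) → ℝ) (h2 : Module.finrank ℝ (recSub p) = j)
    (hA : AEquiv (LorDSM p) (lightNormalForm j k n hj hjn)) : LLightLike (recSub p) := by
  obtain ⟨h, H, hh, hh', -, hH', hg⟩ := hA
  have htop : ((⊤ : ℕ∞) : WithTop ℕ∞) ≠ 0 := by simp
  set π : (Fin (n + 1) → ℝ) →ₗ[ℝ] (Fin j → ℝ) :=
    LinearMap.pi fun i => LinearMap.proj ⟨(i : ℕ) + 1, by omega⟩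
  have hK : n + 1 ≤ Module.finrank ℝ (LinearMap.ker π) + Module.finrank ℝ (recSub p) := by
    have hrn := π.finrank_range_add_finrank_ker
    have hle := Submodule.finrank_le (LinearMap.range π)
    simp only [Module.finrank_fin_fun] at hrn hle
    omega
  have hval : ∀ s t : ℝ, ∀ v ∈ LinearMap.ker π,
      lightNormalForm j k n hj hjn (Pi.single 0 s + t • v)
        = fun i => t ^ 2 * lightNormalForm j k n hj hjn v i := by
    intro s t v hv
    have hv' : ∀ (i : ℕ) (hi : i < j), v ⟨i + 1, by omega⟩ = 0 := fun i hi =>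
      congrFun (LinearMap.mem_ker.1 hv) ⟨i, hi⟩
    funext i
    unfold lightNormalForm
    have hv1 := hv' 0 hj
    simp only [zero_add] at hv1
    have hs : ∀ l : Fin (n + 1), 1 ≤ (l : ℕ) → (Pi.single 0 s : Fin (n + 1) → ℝ) l = 0 :=
      fun l hl => by
        have hl0 : l ≠ 0 := by rintro rfl; simp at hl
        simp [hl0]
    split_ifs with h1 h2
    · simp [hv' i h1]
    · simp only [Pi.add_apply, Pi.smul_apply, smul_eq_mul, hv1, hs ⟨1, by omega⟩ le_rfl, mul_zero,
        zero_add, add_zero, Finset.mul_sum]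
      refine Finset.sum_congr rfl fun l _ => ?_
      split_ifs with hl
      · rw [hs l (by omega)]; ring
      · simp
    · simp
  have hmem : ∀ s : ℝ, h (Pi.single 0 s) - p 0 ∈ recSub p := by
    intro s
    refine apply_sub_mem_recSub p _ h H (hh.differentiable htop) (hh'.differentiable htop)
      (hH'.differentiable htop) hg _ (LinearMap.ker π) hK fun v hv => ?_
    simp only [hval s _ v hv]
    refine hasDerivAt_pi.2 fun i => ?_
    simpa using ((hasDerivAt_id (0 : ℝ)).pow 2).mul_const (lightNormalForm j k n hj hjn v i)
  set a := h (Pi.single 0 1)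
  set b := h (Pi.single 0 0)
  have hab : LorDSM p a = LorDSM p b := by
    have hv0 : ∀ s, lightNormalForm j k n hj hjn (Pi.single 0 s) = 0 := fun s => by
      have := hval s 0 0 (zero_mem _)
      simp only [smul_zero, add_zero] at this
      rw [this]; funext i; simp
    have h01 := (hv0 1).trans (hv0 0).symm
    rw [hg] at h01
    exact H.injective h01
  refine LLightLike_of_radical (u := a - b) ?_ ?_ ?_
  · have := (recSub p).sub_mem (hmem 1) (hmem 0)
    rwa [sub_sub_sub_cancel_right] at this
  · intro hab0
    have := congrFun (h.injective (sub_eq_zero.1 hab0)) 0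
    simp at this
  · refine lorIP_eq_zero_of_mem_span ?_
    rintro _ ⟨i, rfl⟩
    have hi := congrFun hab i
    have h0 := congrFun hab 0
    rw [LorDSM_apply p (p 0), LorDSM_apply p (p 0)] at hi h0
    simp only [← lorForm_apply, map_sub, LinearMap.sub_apply] at hi h0 ⊢
    linarith

/-- A light-like subspace has a nonzero radical vector. -/
lemma LLightLike.exists_radical {n : ℕ} {V : Submodule ℝ (Fin (n + 1) → ℝ)} (hV : LLightLike V) :
    ∃ u ∈ V, u ≠ 0 ∧ ∀ v ∈ V, lorIP u v = 0 := by
  obtain ⟨ht, hs⟩ := hV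
  simp only [LTimeLike, LSpaceLike] at ht hs
  push Not at ht hs
  obtain ⟨u, hu, hu0, huu⟩ := hs
  have huu0 : lorIP u u = 0 := le_antisymm huu (ht u hu)
  refine ⟨u, hu, hu0, fun v hv => ?_⟩
  by_contra hne
  set c := lorIP u v
  have hpos := ht (v + (-(lorIP v v + 1) / (2 * c)) • u) (V.add_mem hv (V.smul_mem _ hu))
  have hexp : ∀ t : ℝ, lorIP (v + t • u) (v + t • u) = lorIP v v + 2 * t * c := by
    intro t
    have hcomm : lorForm n v u = c := lorIP_comm v u
    have huu' : lorForm n u u = 0 := huu0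
    have huv : lorForm n u v = c := rfl
    simp only [← lorForm_apply, map_add, map_smul, LinearMap.add_apply, LinearMap.smul_apply,
      smul_eq_mul, hcomm, huv, huu']
    ring
  rw [hexp] at hpos
  have : 2 * (-(lorIP v v + 1) / (2 * c)) * c = -(lorIP v v + 1) := by field_simp
  linarith

lemma lorIP_eq_dotProduct {n : ℕ} {x : Fin (n + 1) → ℝ} (hx : x 0 = 0) (y : Fin (n + 1) → ℝ) :
    lorIP x y = x ⬝ᵥ y := by
  simp [lorIP, hx, dotProduct]

/-- The vectors with vanishing time coordinate orthogonal to a subspace that is not time-like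
have an orthonormal basis of the expected size. -/
lemma exists_orthonormal_frame {n j m : ℕ} (hn : j + m = n) {V : Submodule ℝ (Fin (n + 1) → ℝ)}
    (hV : ¬ LTimeLike V) (hfin : Module.finrank ℝ V = j) :
    ∃ e : Fin m → Fin (n + 1) → ℝ, (∀ l, ∀ v ∈ V, lorIP (e l) v = 0) ∧
      (∀ l l', lorIP (e l) (e l') = if l = l' then 1 else 0) ∧
      ∀ y : Fin (n + 1) → ℝ, y 0 = 0 → (∀ v ∈ V, lorIP y v = 0) → (∀ l, lorIP y (e l) = 0) →
        y = 0 := by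
  set φ := (WithLp.linearEquiv 2 ℝ (Fin (n + 1) → ℝ)).symm
  set τ : Fin (n + 1) → ℝ := Pi.single 0 1
  have hτ : τ ∉ V := fun h => hV ⟨τ, h, by simp [τ, lorIP_eq_succ]⟩
  have hτ0 : τ ≠ 0 := fun h => hτ (h ▸ V.zero_mem)
  set U : Submodule ℝ (EuclideanSpace ℝ (Fin (n + 1))) :=
    (V ⊔ Submodule.span ℝ {τ}).map (φ : (Fin (n + 1) → ℝ) →ₗ[ℝ] _)
  have hU : Module.finrank ℝ U = j + 1 := by
    rw [LinearEquiv.finrank_map_eq]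
    have hdis : V ⊓ Submodule.span ℝ {τ} = ⊥ := by
      rw [← disjoint_iff, Submodule.disjoint_span_singleton' hτ0]
      exact hτ
    have := Submodule.finrank_sup_add_finrank_inf_eq V (Submodule.span ℝ {τ})
    rw [hdis, finrank_bot, hfin, finrank_span_singleton hτ0] at this
    simpa using this
  have hUo : Module.finrank ℝ Uᗮ = m := by
    have := U.finrank_add_finrank_orthogonal
    rw [hU, finrank_euclideanSpace_fin] at this
    omega
  have hmem : ∀ y : Fin (n + 1) → ℝ,
      φ y ∈ Uᗮ ↔ y 0 = 0 ∧ ∀ v ∈ V, lorIP y v = 0 := by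
    intro y
    have hin : ∀ v : Fin (n + 1) → ℝ, inner ℝ (φ v) (φ y) = y ⬝ᵥ v := fun v => by
      simp [φ, EuclideanSpace.inner_eq_star_dotProduct]
    have hyτ : y ⬝ᵥ τ = y 0 := by simp [τ]
    constructor
    · intro hy
      have hall : ∀ v ∈ V ⊔ Submodule.span ℝ {τ}, y ⬝ᵥ v = 0 := fun v hv => by
        rw [← hin]; exact (Submodule.mem_orthogonal _ _).1 hy _ (Submodule.mem_map_of_mem hv)
      have h0 : y 0 = 0 := by
        rw [← hyτ]
        exact hall τ (Submodule.mem_sup_right (Submodule.mem_span_singleton_self τ))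
      exact ⟨h0, fun v hv => by
        rw [lorIP_eq_dotProduct h0]; exact hall v (Submodule.mem_sup_left hv)⟩
    · rintro ⟨h0, hv⟩
      rw [Submodule.mem_orthogonal]
      rintro _ ⟨w, hw, rfl⟩
      obtain ⟨v, hvV, t, ht, rfl⟩ := Submodule.mem_sup.1 hw
      obtain ⟨c, rfl⟩ := Submodule.mem_span_singleton.1 ht
      refine (hin _).trans ?_
      rw [dotProduct_add, dotProduct_smul, hyτ, h0, ← lorIP_eq_dotProduct h0, hv v hvV]
      simp
  set b := (stdOrthonormalBasis ℝ Uᗮ).reindex (finCongr hUo)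
  have hφ : ∀ l, φ (φ.symm (b l)) = b l := fun l => φ.apply_symm_apply _
  have he : ∀ l, φ.symm (b l) 0 = 0 ∧ ∀ v ∈ V, lorIP (φ.symm (b l)) v = 0 := fun l =>
    (hmem _).1 (by rw [hφ]; exact (b l).2)
  refine ⟨fun l => φ.symm (b l), fun l => (he l).2, fun l l' => ?_, fun y h0 hyV hye => ?_⟩
  · have := orthonormal_iff_ite.1 b.orthonormal l l'
    rw [← this, lorIP_eq_dotProduct (he l).1, Submodule.coe_inner,
      EuclideanSpace.inner_eq_star_dotProduct]
    simp [φ, dotProduct_comm]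
  · have hy : φ y ∈ Uᗮ := (hmem y).2 ⟨h0, hyV⟩
    have hz : (⟨φ y, hy⟩ : Uᗮ) = 0 := by
      refine InnerProductSpace.ext_inner_left_basis b.toBasis fun l => ?_
      have := hye l
      rw [lorIP_eq_dotProduct h0] at this
      rw [inner_zero_right, Submodule.coe_inner, EuclideanSpace.inner_eq_star_dotProduct, ← this]
      simp [φ]
    have : φ y = 0 := congrArg Subtype.val hz
    simpa using this

/-- A linearly independent family extends to a basis indexed by `Fin N`. -/
lemma LinearIndependent.exists_basis_castLE {K W : Type*} [Field K] [AddCommGroup W] [Module K W]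
    [FiniteDimensional K W] {r N : ℕ} (hN : Module.finrank K W = N) {u : Fin r → W}
    (hu : LinearIndependent K u) (hr : r ≤ N) :
    ∃ b : Module.Basis (Fin N) K W, ∀ i, b (Fin.castLE hr i) = u i := by
  set b₀ := Module.Basis.sumExtend hu
  have hb₀ : ∀ i, b₀ (Sum.inl i) = u i := fun i => by
    simp only [b₀, Module.Basis.sumExtend, Module.Basis.reindex_apply,
      Module.Basis.extend_apply_self]
    rfl
  have : Finite (Fin r ⊕ Module.Basis.sumExtendIndex hu) := Module.Finite.finite_basis b₀
  have : Finite (Module.Basis.sumExtendIndex hu) := Finite.sum_right (Fin r)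
  have := Fintype.ofFinite (Module.Basis.sumExtendIndex hu)
  have hcard := Module.finrank_eq_card_basis b₀
  rw [hN, Fintype.card_sum, Fintype.card_fin] at hcard
  set σ : Fin r ⊕ Module.Basis.sumExtendIndex hu ≃ Fin N :=
    ((Equiv.refl _).sumCongr (Fintype.equivFin _)).trans
      (finSumFinEquiv.trans (finCongr hcard.symm))
  refine ⟨b₀.reindex σ, fun i => ?_⟩
  have hσ : σ (Sum.inl i) = Fin.castLE hr i := by
    ext; simp [σ]
  rw [Module.Basis.reindex_apply, ← hσ, Equiv.symm_apply_apply, hb₀]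

/-- Linear coordinates adapted to a light-like subspace `V`: the pairings with a basis of `V` are
coordinates, and the Lorentzian square is `x₀x₁ + ∑_{i > j} x_i²` up to a function of
`x₁, …, x_j`. -/
lemma LLightLike.exists_adapted_coordinates {n j : ℕ} (hj : 1 ≤ j) (hjn : j < n)
    {V : Submodule ℝ (Fin (n + 1) → ℝ)} (hV : LLightLike V) (hfin : Module.finrank ℝ V = j) :
    ∃ (A : (Fin (n + 1) → ℝ) ≃ₗ[ℝ] (Fin (n + 1) → ℝ)) (w : Module.Basis (Fin j) ℝ V)
      (P : (Fin j → ℝ) → ℝ), ContDiff ℝ (⊤ : ℕ∞) P ∧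
      (∀ x i, lorIP (A x) (w i) = x ⟨(i : ℕ) + 1, by omega⟩) ∧
      ∀ x, lorIP (A x) (A x) = x 0 * x ⟨1, by omega⟩
        + (∑ l : Fin (n + 1), if j + 1 ≤ (l : ℕ) then x l ^ 2 else 0)
        + P (fun i => x ⟨(i : ℕ) + 1, by omega⟩) := by
  obtain ⟨u, hu, hu0, huV⟩ := hV.exists_radical
  obtain ⟨m, hm⟩ : ∃ m, j + m = n := ⟨n - j, by omega⟩
  obtain ⟨e, heV, hee, hecomplete⟩ := exists_orthonormal_frame hm hV.1 hfin
  have htime : u 0 ≠ 0 := fun h => hu0 ((lorIP_self_of_time_eq_zero h).2 (huV u hu))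
  obtain ⟨w, hw⟩ : ∃ w : Module.Basis (Fin j) ℝ V, (w ⟨0, hj⟩ : Fin (n + 1) → ℝ) = u := by
    have hli : LinearIndependent ℝ (fun _ : Fin 1 => (⟨u, hu⟩ : V)) :=
      LinearIndependent.of_subsingleton 0 (by simpa using hu0)
    obtain ⟨w, hw⟩ := hli.exists_basis_castLE hfin hj
    exact ⟨w, congrArg Subtype.val (hw 0)⟩
  have hwV : ∀ y : Fin (n + 1) → ℝ, (∀ i, lorIP y (w i) = 0) → ∀ v ∈ V, lorIP y v = 0 := by
    intro y hy v hv
    have : (lorForm n y).comp V.subtype = 0 := w.ext fun i => hy i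
    exact congrArg (fun L => L ⟨v, hv⟩) this
  set G : (Fin (n + 1) → ℝ) →ₗ[ℝ] (Fin j → ℝ) × (Fin m → ℝ) :=
    (LinearMap.pi fun i => (lorForm n).flip (w i)).prod
      (LinearMap.pi fun l => (lorForm n).flip (e l))
  have hG1 : ∀ y i, (G y).1 i = lorIP y (w i) := fun y i => rfl
  have hG2 : ∀ y l, (G y).2 l = lorIP y (e l) := fun y l => rfl
  have hker : LinearMap.ker G ≤ Submodule.span ℝ {u} := by
    intro y hy
    rw [LinearMap.mem_ker] at hy
    have hyw : ∀ v ∈ V, lorIP y v = 0 := hwV y fun i => by rw [← hG1, hy]; rfl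
    have hye : ∀ l, lorIP y (e l) = 0 := fun l => by rw [← hG2, hy]; rfl
    have hlin : ∀ z, lorIP (y - (y 0 / u 0) • u) z = lorIP y z - (y 0 / u 0) * lorIP u z :=
      fun z => by simp [← lorForm_apply]
    have hzero : y - (y 0 / u 0) • u = 0 := by
      refine hecomplete _ (by simp [htime]) (fun v hv => ?_) fun l => ?_
      · rw [hlin, hyw v hv, huV v hv]; simp
      · rw [hlin, hye, lorIP_comm u, heV l u hu]; simp
    rw [sub_eq_zero.1 hzero]
    exact Submodule.smul_mem _ _ (Submodule.mem_span_singleton_self u)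
  have hsurj : LinearMap.range G = ⊤ := by
    refine Submodule.eq_top_of_finrank_eq (le_antisymm (Submodule.finrank_le _) ?_)
    have hrn := G.finrank_range_add_finrank_ker
    have hle := Submodule.finrank_mono hker
    rw [finrank_span_singleton hu0] at hle
    rw [Module.finrank_prod]
    simp only [Module.finrank_fin_fun] at hrn ⊢
    omega
  obtain ⟨s, hs⟩ := G.exists_rightInverse_of_surjective hsurj
  have hGs : ∀ z, G (s z) = z := fun z => congrArg (fun L => L z) hs
  set f : (Fin j → ℝ) →ₗ[ℝ] (Fin (n + 1) → ℝ) := s.comp (LinearMap.inl ℝ _ _)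
  have hfw : ∀ a i, lorIP (f a) (w i) = a i := fun a i => by
    rw [← hG1]; exact congrFun (congrArg Prod.fst (hGs (a, 0))) i
  have hfe : ∀ a l, lorIP (f a) (e l) = 0 := fun a l => by
    rw [← hG2]; exact congrFun (congrArg Prod.snd (hGs (a, 0))) l
  set α : (Fin (n + 1) → ℝ) →ₗ[ℝ] (Fin j → ℝ) :=
    LinearMap.pi fun i => LinearMap.proj ⟨(i : ℕ) + 1, by omega⟩
  set β : (Fin (n + 1) → ℝ) →ₗ[ℝ] (Fin m → ℝ) :=
    LinearMap.pi fun l => LinearMap.proj ⟨j + 1 + (l : ℕ), by omega⟩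
  set A₀ : (Fin (n + 1) → ℝ) →ₗ[ℝ] (Fin (n + 1) → ℝ) :=
    ((2 : ℝ)⁻¹ • (LinearMap.proj 0 : (Fin (n + 1) → ℝ) →ₗ[ℝ] ℝ)).smulRight u + f.comp α
      + (Fintype.linearCombination ℝ e).comp β
  have hA₀ : ∀ x, A₀ x = (2⁻¹ * x 0) • u + f (α x) + ∑ l, β x l • e l := fun x => rfl
  have hpair : ∀ x z, lorIP (A₀ x) z
      = 2⁻¹ * x 0 * lorIP u z + lorIP (f (α x)) z + ∑ l, β x l * lorIP (e l) z := by
    intro x z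
    rw [hA₀]
    simp [← lorForm_apply, LinearMap.sum_apply]
  have hAw : ∀ x i, lorIP (A₀ x) (w i) = α x i := fun x i => by
    rw [hpair, huV _ (w i).2, hfw]
    simp [heV _ _ (w i).2]
  have hAe : ∀ x l, lorIP (A₀ x) (e l) = β x l := fun x l => by
    rw [hpair, hfe, lorIP_comm u, heV l u hu]
    simp [hee]
  have hAu : ∀ x, lorIP (A₀ x) u = x ⟨1, by omega⟩ := fun x => by
    rw [← hw, hAw]; rfl
  have hinj : Function.Injective A₀ := by
    rw [← LinearMap.ker_eq_bot, LinearMap.ker_eq_bot']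
    intro x hx
    have hα : α x = 0 := funext fun i => by rw [← hAw, hx]; simp [lorIP]
    have hβ : β x = 0 := funext fun l => by rw [← hAe, hx]; simp [lorIP]
    have hx0 : x 0 = 0 := by
      have := hA₀ x
      rw [hx, hα, hβ] at this
      simpa [hu0] using this.symm
    funext i
    rcases Nat.eq_zero_or_pos i with hi | hi
    · rw [show i = 0 from Fin.ext hi]; exact hx0
    · by_cases hij : (i : ℕ) ≤ j
      · have := congrFun hα ⟨i - 1, by omega⟩
        have hi' : (⟨(i : ℕ) - 1 + 1, by omega⟩ : Fin (n + 1)) = i := Fin.ext (by simp; omega)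
        simpa [α, hi'] using this
      · have := congrFun hβ ⟨i - (j + 1), by omega⟩
        have hi' : (⟨j + 1 + ((i : ℕ) - (j + 1)), by omega⟩ : Fin (n + 1)) = i :=
          Fin.ext (by simp; omega)
        simpa [β, hi'] using this
  refine ⟨LinearEquiv.ofInjectiveEndo A₀ hinj, w, fun a => lorIP (f a) (f a), ?_, hAw,
    fun x => ?_⟩
  · have hf : ContDiff ℝ (⊤ : ℕ∞) f := f.toContinuousLinearMap.contDiff
    have hfi := contDiff_pi.1 hf
    unfold lorIP
    fun_prop
  · change lorIP (A₀ x) (A₀ x) = _ + lorIP (f (α x)) (f (α x))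
    have hsum : (∑ l : Fin (n + 1), if j + 1 ≤ (l : ℕ) then x l ^ 2 else 0)
        = ∑ l, β x l * β x l := by
      symm
      refine Fintype.sum_of_injective (fun l : Fin m => (⟨j + 1 + l, by omega⟩ : Fin (n + 1)))
        (fun a b hab => by simpa [Fin.ext_iff] using hab) _ _ (fun i hi => ?_) fun l => ?_
      · rw [if_neg]
        exact fun hij => hi ⟨⟨i - (j + 1), by omega⟩, Fin.ext (by simp; omega)⟩
      · simp [β, pow_two, add_assoc]
    rw [hpair, lorIP_comm u, hAu, lorIP_comm (f (α x)), hpair x (f (α x)), hsum]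
    simp only [lorIP_comm (e _), hAe, hfe]
    have hfu : lorIP u (f (α x)) = x ⟨1, by omega⟩ := by
      rw [← hw, lorIP_comm, hfw]; rfl
    rw [hfu]
    simp
    ring

/-- Adding a function of the coordinates before `c` to the coordinate `c`. -/
def shearEquiv {N : ℕ} (c : Fin N) (q : (Fin N → ℝ) → ℝ)
    (hq : ∀ z z' : Fin N → ℝ, (∀ i < c, z i = z' i) → q z = q z') : (Fin N → ℝ) ≃ (Fin N → ℝ) where
  toFun z := z + Pi.single c (q z)
  invFun z := z - Pi.single c (q z)
  left_inv z := by
    have : q (z + Pi.single c (q z)) = q z := hq _ _ fun i hi => by simp [hi.ne]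
    simp [this]
  right_inv z := by
    have : q (z - Pi.single c (q z)) = q z := hq _ _ fun i hi => by simp [hi.ne]
    simp [this]

lemma AEquiv_of_LLightLike {j k n : ℕ} (hj : 1 ≤ j) (hjn : j < n) (hjk : j < k)
    (p : Fin (k + 1) → Fin (n + 1) → ℝ) (h2 : Module.finrank ℝ (recSub p) = j)
    (hL : LLightLike (recSub p)) : AEquiv (LorDSM p) (lightNormalForm j k n hj hjn) := by
  obtain ⟨A, w, P, hP, hAw, hAA⟩ := hL.exists_adapted_coordinates hj hjn h2
  have hpV : ∀ i, p i - p 0 ∈ recSub p := fun i => Submodule.subset_span ⟨i, rfl⟩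
  set c : Fin (k + 1) → Fin j → ℝ := fun i => w.repr ⟨p i - p 0, hpV i⟩
  have hc : ∀ i, p i - p 0 = ∑ l, c i l • (w l : Fin (n + 1) → ℝ) := fun i => by
    have := congrArg Subtype.val (w.sum_repr ⟨p i - p 0, hpV i⟩)
    rw [AddSubmonoidClass.coe_finsetSum] at this
    exact this.symm
  set u : Fin (j + 1) → Fin (k + 1) → ℝ :=
    Fin.snoc (fun l i => -2 * c i l) (fun _ => 1)
  have hu_last : ∀ i, u (Fin.last j) i = 1 := fun i => by simp [u]
  have hu_cast : ∀ l i, u (Fin.castSucc l) i = -2 * c i l := fun l i => by simp [u]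
  have hu : LinearIndependent ℝ u := by
    rw [Fintype.linearIndependent_iff]
    intro a ha
    have hai : ∀ i, (∑ l : Fin j, a l.castSucc * (-2 * c i l)) + a (Fin.last j) = 0 := by
      intro i
      have := congrFun ha i
      simpa [Fin.sum_univ_castSucc, hu_last, hu_cast, Finset.sum_apply] using this
    have hc0 : ∀ l, c 0 l = 0 := fun l => by
      have : (⟨p 0 - p 0, hpV 0⟩ : recSub p) = 0 := by ext; simp
      simp only [c, this, map_zero, Finsupp.coe_zero, Pi.zero_apply]
    have hlast : a (Fin.last j) = 0 := by simpa [hc0] using hai 0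
    set L : recSub p →ₗ[ℝ] ℝ := w.constr ℝ fun l => a l.castSucc
    have hLp : ∀ i, L ⟨p i - p 0, hpV i⟩ = 0 := fun i => by
      have h := hai i
      rw [hlast, add_zero] at h
      have hL' : L ⟨p i - p 0, hpV i⟩ = ∑ l, c i l * a l.castSucc := by
        simp [L, Module.Basis.constr_apply_fintype, c]
      have hneg : (∑ l : Fin j, a l.castSucc * (-2 * c i l))
          = -2 * ∑ l, c i l * a l.castSucc := by
        rw [Finset.mul_sum]; exact Finset.sum_congr rfl fun l _ => by ring
      rw [hL']
      linarith
    have hL0 : ∀ v (hv : v ∈ recSub p), L ⟨v, hv⟩ = 0 := by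
      intro v hv
      have hspan : recSub p ≤ (LinearMap.ker L).map (recSub p).subtype := by
        refine Submodule.span_le.2 ?_
        rintro _ ⟨i, rfl⟩
        exact ⟨⟨p i - p 0, hpV i⟩, hLp i, rfl⟩
      obtain ⟨⟨v', hv'⟩, hk, rfl⟩ := hspan hv
      exact hk
    intro l
    induction l using Fin.lastCases with
    | last => exact hlast
    | cast l =>
      have := hL0 (w l) (w l).2
      simpa [L] using this
  obtain ⟨b, hb⟩ := hu.exists_basis_castLE (Module.finrank_fin_fun ℝ) (by omega : j + 1 ≤ k + 1)
  set q : (Fin (k + 1) → ℝ) → ℝ := fun z => P fun i => z ⟨i, by omega⟩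
  have hqs : ContDiff ℝ (⊤ : ℕ∞) q := hP.comp (by fun_prop)
  have hsingle : ContDiff ℝ (⊤ : ℕ∞)
      fun z => (Pi.single (⟨j, by omega⟩ : Fin (k + 1)) (q z) : Fin (k + 1) → ℝ) :=
    (ContinuousLinearMap.single ℝ (fun _ : Fin (k + 1) => ℝ) ⟨j, by omega⟩).contDiff.comp hqs
  set S := shearEquiv (⟨j, by omega⟩ : Fin (k + 1)) q fun z z' hz => by
    simp only [q]
    congr 1
    funext i
    exact hz _ i.2
  set κ : Fin (k + 1) → ℝ := fun i => lorIP (p i - p 0) (p i - p 0)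
  set B := b.equivFun.symm
  set H : (Fin (k + 1) → ℝ) ≃ (Fin (k + 1) → ℝ) :=
    (S.trans (B.toEquiv.trans (Equiv.addRight κ))).symm
  have hBs : ContDiff ℝ (⊤ : ℕ∞) B := B.toContinuousLinearEquiv.contDiff
  have hBs' : ContDiff ℝ (⊤ : ℕ∞) B.symm := B.toContinuousLinearEquiv.symm.contDiff
  refine ⟨A.toEquiv.trans (Equiv.addRight (p 0)), H, ?_, ?_, ?_, ?_, ?_⟩
  · exact A.toContinuousLinearEquiv.contDiff.add contDiff_const
  · exact A.toContinuousLinearEquiv.symm.contDiff.comp (contDiff_id.add contDiff_const)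
  · have h1 : ContDiff ℝ (⊤ : ℕ∞) S.symm := contDiff_id.sub hsingle
    exact h1.comp (hBs'.comp (contDiff_id.add contDiff_const))
  · have h1 : ContDiff ℝ (⊤ : ℕ∞) S := contDiff_id.add hsingle
    exact (hBs.comp h1).add contDiff_const
  funext x
  refine H.symm_apply_eq.1 ?_
  set g := lightNormalForm j k n hj hjn x
  have hg_lt : ∀ (i : Fin j), g ⟨i, by omega⟩ = x ⟨(i : ℕ) + 1, by omega⟩ := fun i => by
    simp [g, lightNormalForm]
  have hg_eq : g ⟨j, by omega⟩ = x 0 * x ⟨1, by omega⟩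
      + ∑ l : Fin (n + 1), if j + 1 ≤ (l : ℕ) then x l ^ 2 else 0 := by
    simp [g, lightNormalForm]
  have hg_gt : ∀ i : Fin (k + 1), j < (i : ℕ) → g i = 0 := fun i hi => by
    simp [g, lightNormalForm, hi.ne', hi.le]
  have hS_lt : ∀ (i : Fin j), S g ⟨i, by omega⟩ = x ⟨(i : ℕ) + 1, by omega⟩ := fun i => by
    have hne : (⟨i, by omega⟩ : Fin (k + 1)) ≠ ⟨j, by omega⟩ := by simp [Fin.ext_iff, i.2.ne]
    rw [← hg_lt]
    simp [S, shearEquiv, hne]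
  have hS_eq : S g ⟨j, by omega⟩ = lorIP (A x) (A x) := by
    rw [hAA, ← hg_eq]
    simp [S, shearEquiv, q, hg_lt]
  have hS_gt : ∀ i : Fin (k + 1), j < (i : ℕ) → S g i = 0 := fun i hi => by
    have hne : i ≠ ⟨j, by omega⟩ := by simp [Fin.ext_iff, hi.ne']
    simp [S, shearEquiv, hne, hg_gt i hi]
  have hBS : B (S g) = ∑ l : Fin (j + 1), S g (Fin.castLE (by omega) l) • u l := by
    rw [Module.Basis.equivFun_symm_apply]
    symm
    refine Fintype.sum_of_injective (Fin.castLE (by omega)) (Fin.castLE_injective _) _ _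
      (fun i hi => ?_) fun l => by rw [hb]
    rw [hS_gt i, zero_smul]
    by_contra hij
    exact hi ⟨⟨i, by omega⟩, rfl⟩
  funext i
  change B (S g) i + κ i = LorDSM p (A x + p 0) i
  have hpair : lorIP (A x) (p i - p 0) = ∑ l : Fin j, c i l * x ⟨(l : ℕ) + 1, by omega⟩ := by
    rw [hc, ← lorForm_apply, map_sum]
    simp only [map_smul, lorForm_apply, hAw, smul_eq_mul]
  have hsum : (∑ l : Fin j, x ⟨(l : ℕ) + 1, by omega⟩ * (-2 * c i l))
      = -2 * ∑ l : Fin j, c i l * x ⟨(l : ℕ) + 1, by omega⟩ := by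
    rw [Finset.mul_sum]; exact Finset.sum_congr rfl fun l _ => by ring
  have hBi : B (S g) i = -2 * lorIP (A x) (p i - p 0) + lorIP (A x) (A x) := by
    rw [hBS, Fin.sum_univ_castSucc, Pi.add_apply, Finset.sum_apply, hpair, ← hsum]
    simp only [Pi.smul_apply, smul_eq_mul, hu_last, hu_cast, mul_one]
    exact congrArg₂ _ (Finset.sum_congr rfl fun l _ => congrArg (· * _) (hS_lt l)) hS_eq
  rw [hBi, LorDSM_apply p (p 0), add_sub_cancel_right]
  ring

theorem theorem4_1c (j k n : ℕ) (hj : 1 ≤ j) (hjn : j < n) (hjk : j < k)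
    (p : Fin (k + 1) → Fin (n + 1) → ℝ)
    (h1 : Module.finrank ℝ (recSubUpTo p j) = j)
    (h2 : Module.finrank ℝ (recSub p) = j) :
    AEquiv (LorDSM p)
        (fun (x : Fin (n + 1) → ℝ) (i : Fin (k + 1)) =>
          if h : (i : ℕ) < j then x ⟨(i : ℕ) + 1, by omega⟩
          else if (i : ℕ) = j then
            x 0 * x ⟨1, by omega⟩
              + ∑ l : Fin (n + 1), if j + 1 ≤ (l : ℕ) then x l ^ 2 else 0
          else 0)
      ↔ LLightLike (recSub p) := by
  exact ⟨LLightLike_of_AEquiv hj hjn p h2, AEquiv_of_LLightLike hj hjn hjk p h2⟩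
end
end
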